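/- Let α ≥ 1, let μ be a positive Borel measure on ℂ₊, let n ∈ ℤ, and suppose 𝒞_α[μ_n] < ∞. Then there exists a bounded interval I ⊂ iℝ with |I| = 2^{n+1} such that 𝒞_α[μ_n] ≤ 2^{α+1}·μ_n(Q_I)/|I|^α. -/

import Mathlib

open MeasureTheory Set Complex Filter
open scoped ENNReal NNReal

noncomputable section

/-- The Laplace transform of `f : (0,∞) → ℂ`. -/
def laplace (f : ℝ → ℂ) (z : ℂ) : ℂ :=
  ∫ t in Ioi (0:ℝ), Complex.exp (-z * t) * f t

/-- The Laplace transform of `f : (0,τ) → ℂ`. -/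
def laplaceOn (τ : ℝ) (f : ℝ → ℂ) (z : ℂ) : ℂ :=
  ∫ t in Ioo (0:ℝ) τ, Complex.exp (-z * t) * f t

/-- The Carleson square `Q_I` over the interval `I = i[a,b]` on the imaginary axis. -/
def carlesonSquare (a b : ℝ) : Set ℂ :=
  {z : ℂ | z.im ∈ Icc a b ∧ z.re ∈ Ioo 0 (b - a)}

/-- The `α`-Carleson intensity of a measure on the right half-plane. -/
def carlesonIntensity (α : ℝ) (ν : Measure ℂ) : ℝ≥0∞ :=
  ⨆ (a : ℝ) (b : ℝ) (_ : a < b),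
    ν (carlesonSquare a b) / ENNReal.ofReal ((b - a) ^ α)

/-- The dyadic strip `S_n = {2^n ≤ Re z < 2^(n+1)}`. -/
def dyadicStrip (n : ℤ) : Set ℂ :=
  {z : ℂ | (2:ℝ) ^ n ≤ z.re ∧ z.re < (2:ℝ) ^ (n + 1)}

/-- `μ_n`, the restriction of `μ` to the dyadic strip `S_n`. -/
def stripPart (μ : Measure ℂ) (n : ℤ) : Measure ℂ := μ.restrict (dyadicStrip n)

/-- A Young function: increasing, continuous, convex on `[0,∞)`, with
`Φ(t)/t → 0` as `t → 0⁺` and `Φ(t)/t → ∞` as `t → ∞`. -/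
def YoungFunction (Φ : ℝ → ℝ) : Prop :=
  (∀ t, 0 ≤ t → 0 ≤ Φ t) ∧ MonotoneOn Φ (Ici 0) ∧ ContinuousOn Φ (Ici 0) ∧
    ConvexOn ℝ (Ici 0) Φ ∧
    Tendsto (fun t => Φ t / t) (nhdsWithin 0 (Ioi 0)) (nhds 0) ∧
    Tendsto (fun t => Φ t / t) atTop atTop

/-- The Luxemburg (Orlicz) norm of `f` on `J` w.r.t. the Young function `Φ`. -/
def luxNorm (Φ : ℝ → ℝ) (J : Set ℝ) (f : ℝ → ℂ) : ℝ≥0∞ :=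
  ⨅ (k : ℝ) (_ : 0 < k)
    (_ : (∫⁻ s in J, ENNReal.ofReal (Φ (‖f s‖ / k))) ≤ 1), ENNReal.ofReal k

/-- The complementary Young function `Φᶜ(s) = sup_{t ≥ 0} (st - Φ(t))`. -/
def youngConj (Φ : ℝ → ℝ) (s : ℝ) : ℝ :=
  sSup {u : ℝ | ∃ t : ℝ, 0 ≤ t ∧ u = s * t - Φ t}

lemma measurableSet_dyadicStrip (n : ℤ) : MeasurableSet (dyadicStrip n) :=
  (measurableSet_le measurable_const Complex.measurable_re).inter
    (measurableSet_lt Complex.measurable_re measurable_const)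

lemma exists_nat_mul_le_le {L : ℝ} (k : ℕ) {t : ℝ} (ht : 0 ≤ t) (htk : t ≤ (k + 1) * L) :
    ∃ j < k + 1, (j : ℝ) * L ≤ t ∧ t ≤ j * L + L := by
  induction k with
  | zero => exact ⟨0, by simp, by simpa using ht, by simpa using htk⟩
  | succ k ih =>
    by_cases h : t ≤ (k + 1) * L
    · obtain ⟨j, hj, h1, h2⟩ := ih h
      exact ⟨j, by omega, h1, h2⟩
    · refine ⟨k + 1, by omega, ?_, ?_⟩
      · push_cast
        exact (not_le.mp h).le
      · push_cast at htk ⊢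
        linarith

/-- A Carleson square over an interval of length at most `N * 2 ^ (n + 1)` has `μ_n`-mass at most
`N` times the largest mass of a square over an interval of length `2 ^ (n + 1)`. -/
lemma stripPart_carlesonSquare_le (μ : Measure ℂ) (n : ℤ) {M : ℝ≥0∞}
    (hM : ∀ c, stripPart μ n (carlesonSquare c (c + (2:ℝ) ^ (n + 1))) ≤ M)
    {a b : ℝ} {N : ℕ} (hN : N ≠ 0) (hab : b - a ≤ N * (2:ℝ) ^ (n + 1)) :
    stripPart μ n (carlesonSquare a b) ≤ N * M := by
  obtain ⟨k, rfl⟩ := Nat.exists_eq_succ_of_ne_zero hN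
  set L : ℝ := (2:ℝ) ^ (n + 1) with hL
  have hsub : carlesonSquare a b ∩ dyadicStrip n ⊆
      ⋃ j ∈ Finset.range (k + 1), carlesonSquare (a + j * L) (a + j * L + L) := by
    rintro z ⟨⟨⟨hz1, hz2⟩, hz3, -⟩, -, hz4⟩
    obtain ⟨j, hj, h1, h2⟩ := exists_nat_mul_le_le (L := L) k (t := z.im - a) (by linarith)
      (by push_cast at hab; linarith)
    simp only [mem_iUnion, Finset.mem_range]
    exact ⟨j, hj, ⟨by linarith, by linarith⟩, hz3, by linarith⟩
  calc stripPart μ n (carlesonSquare a b)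
      = μ (carlesonSquare a b ∩ dyadicStrip n ∩ dyadicStrip n) := by
        rw [stripPart, Measure.restrict_apply' (measurableSet_dyadicStrip n), inter_assoc,
          inter_self]
    _ = stripPart μ n (carlesonSquare a b ∩ dyadicStrip n) := by
        rw [stripPart, Measure.restrict_apply' (measurableSet_dyadicStrip n)]
    _ ≤ ∑ j ∈ Finset.range (k + 1),
          stripPart μ n (carlesonSquare (a + j * L) (a + j * L + L)) :=
        (measure_mono hsub).trans (measure_biUnion_finset_le _ _)
    _ ≤ ∑ _j ∈ Finset.range (k + 1), M := Finset.sum_le_sum fun j _ => hM _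
    _ = _ := by simp

lemma stripPart_carlesonSquare_eq_zero (μ : Measure ℂ) (n : ℤ) {a b : ℝ}
    (hab : b - a ≤ (2:ℝ) ^ n) : stripPart μ n (carlesonSquare a b) = 0 := by
  rw [stripPart, Measure.restrict_apply' (measurableSet_dyadicStrip n)]
  convert measure_empty (μ := μ)
  ext z
  simp only [carlesonSquare, dyadicStrip, mem_inter_iff, mem_ofPred_eq, mem_Ioo,
    mem_empty_iff_false, iff_false]
  rintro ⟨⟨-, -, h1⟩, h2, -⟩
  linarith

lemma ENNReal.exists_iSup_le_two_mul {ι : Sort*} [Nonempty ι] {f : ι → ℝ≥0∞}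
    (hf : ⨆ i, f i ≠ ⊤) : ∃ i, ⨆ i, f i ≤ 2 * f i := by
  by_cases h0 : ⨆ i, f i = 0
  · exact ⟨Classical.arbitrary ι, by simp [h0]⟩
  · obtain ⟨i, hi⟩ := lt_iSup_iff.mp (ENNReal.half_lt_self h0 hf)
    refine ⟨i, ?_⟩
    rw [mul_comm]
    exact (ENNReal.div_le_iff (by simp) (by simp)).mp hi.le

/-- for `α ≥ 1` and `n ∈ ℤ`, if `𝒞_α[μ_n] < ∞` then there is an interval
`I ⊂ iℝ` with `|I| = 2^{n+1}` such that `𝒞_α[μ_n] ≤ 2^{α+1} μ_n(Q_I)/|I|^α`. -/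
theorem carlesonIntensity_attained_on_dyadic_interval (α : ℝ) (hα : 1 ≤ α)
    (μ : Measure ℂ) (hμ : μ {z : ℂ | z.re ≤ 0} = 0) (n : ℤ)
    (hfin : carlesonIntensity α (stripPart μ n) ≠ ⊤) :
    ∃ a b : ℝ, a < b ∧ b - a = (2:ℝ) ^ (n + 1) ∧
      carlesonIntensity α (stripPart μ n) ≤
        ENNReal.ofReal ((2:ℝ) ^ (α + 1)) *
          (stripPart μ n (carlesonSquare a b) / ENNReal.ofReal ((b - a) ^ α)) := by
  set ν := stripPart μ n with hν
  set L : ℝ := (2:ℝ) ^ (n + 1) with hL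
  have hLpos : 0 < L := by positivity
  have hLn : L = 2 * (2:ℝ) ^ n := by rw [hL, zpow_add_one₀ two_ne_zero, mul_comm]
  have hLα : 0 < L ^ α := Real.rpow_pos_of_pos hLpos α
  have hle : ∀ a b : ℝ, a < b →
      ν (carlesonSquare a b) / ENNReal.ofReal ((b - a) ^ α) ≤ carlesonIntensity α ν :=
    fun a b hab => le_iSup_of_le a (le_iSup_of_le b (le_iSup_of_le hab le_rfl))
  have hsup : ⨆ c : ℝ, ν (carlesonSquare c (c + L)) ≠ ⊤ := by
    refine ne_top_of_le_ne_top (ENNReal.mul_ne_top hfin (ENNReal.ofReal_ne_top (r := L ^ α)))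
      (iSup_le fun c => ?_)
    have h := hle c (c + L) (by linarith)
    rw [add_sub_cancel_left] at h
    exact (ENNReal.div_le_iff (by simpa using hLα) ENNReal.ofReal_ne_top).mp h
  obtain ⟨c, hc⟩ := ENNReal.exists_iSup_le_two_mul hsup
  refine ⟨c, c + L, by linarith, by ring, ?_⟩
  rw [add_sub_cancel_left]
  refine iSup_le fun a => iSup_le fun b => iSup_le fun hab => ?_
  have hℓ : 0 < b - a := sub_pos.mpr hab
  have hℓα : 0 < (b - a) ^ α := Real.rpow_pos_of_pos hℓ α
  rcases le_or_gt (b - a) ((2:ℝ) ^ n) with hs | hs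
  · rw [hν, stripPart_carlesonSquare_eq_zero μ n hs]
    simp
  set x : ℝ := (b - a) / L with hx
  have hx2 : 1 < 2 * x := by
    rw [hx, ← mul_div_assoc, lt_div_iff₀ hLpos]
    linarith
  have hN : ⌈x⌉₊ ≠ 0 := (Nat.ceil_pos.mpr (by linarith)).ne'
  have hNx : (⌈x⌉₊ : ℝ) ≤ 2 * x := by
    rcases le_or_gt x 1 with h | h
    · have h1 : (⌈x⌉₊ : ℝ) ≤ 1 := by exact_mod_cast Nat.ceil_le.mpr (by simpa using h)
      linarith
    · linarith [Nat.ceil_lt_add_one (a := x) (by linarith)]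
  have hNα : (⌈x⌉₊ : ℝ) ≤ (2 * x) ^ α := hNx.trans (Real.self_le_rpow_of_one_le hx2.le hα)
  have hreal : (2 * x) ^ α * 2 = (2:ℝ) ^ (α + 1) / L ^ α * (b - a) ^ α := by
    rw [Real.mul_rpow two_pos.le (by linarith), hx, Real.div_rpow hℓ.le hLpos.le,
      Real.rpow_add_one two_ne_zero]
    ring
  rw [ENNReal.div_le_iff (by simpa using hℓα) ENNReal.ofReal_ne_top]
  calc ν (carlesonSquare a b)
      ≤ (⌈x⌉₊ : ℝ≥0∞) * ⨆ c : ℝ, ν (carlesonSquare c (c + L)) :=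
        stripPart_carlesonSquare_le μ n (fun c => le_iSup (fun c => ν (carlesonSquare c (c + L))) c)
          hN ((div_le_iff₀ hLpos).mp (Nat.le_ceil x))
    _ ≤ ENNReal.ofReal ((2 * x) ^ α) * (2 * ν (carlesonSquare c (c + L))) := by
        gcongr
        rw [← ENNReal.ofReal_natCast]
        exact ENNReal.ofReal_le_ofReal hNα
    _ = ENNReal.ofReal ((2 * x) ^ α * 2) * ν (carlesonSquare c (c + L)) := by
        rw [ENNReal.ofReal_mul' two_pos.le, ENNReal.ofReal_ofNat, mul_assoc]
    _ = _ := by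
        rw [hreal, ENNReal.ofReal_mul' hℓα.le, ENNReal.ofReal_div_of_pos hLα]
        simp only [div_eq_mul_inv]
        ring
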